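/- arXiv:1905.11136 — 5 statements merged into one kernel-verified Lean document; each statement's English description precedes it below -/
import Mathlib

section
/- Let n, a be positive natural numbers. For a matrix X ∈ ℝ^{n×a} with rows x_1,…,x_n ∈ ℝ^a, and for a multi-index α = (α_1,…,α_a) ∈ ℕ^a, let p_α(X) = Σ_{i=1}^n Π_{j=1}^a (x_i)_j^{α_j} denote the Power-sum Multi-symmetric Polynomial of degree α. Then for arbitrary X, X' ∈ ℝ^{n×a}: there exists a permutation σ of {1,…,n} such that X' is obtained from X by permuting its rows according to σ (i.e., x'_i = x_{σ(i)} for all i) if and only if p_α(X) = p_α(X') for every multi-index α ∈ ℕ^a with |α| = Σ_j α_j ≤ n. -/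
/-- Over a field of characteristic zero, equal power sums up to degree `n` force equal elementary
symmetric functions up to degree `n`. -/
theorem Finset.esymm_map_val_eq_of_sum_pow_eq {ι K : Type*} [Fintype ι] [Field K] [CharZero K]
    {f g : ι → K} {n : ℕ} (h : ∀ k ≤ n, ∑ i, f i ^ k = ∑ i, g i ^ k) (k : ℕ) (hk : k ≤ n) :
    (univ.val.map f).esymm k = (univ.val.map g).esymm k := by
  have newton (f : ι → K) (k : ℕ) : (k : K) * (univ.val.map f).esymm k = (-1) ^ (k + 1) *
      ∑ a ∈ HasAntidiagonal.antidiagonal k with a.1 < k,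
        (-1) ^ a.1 * (univ.val.map f).esymm a.1 * ∑ i, f i ^ a.2 := by
    simp_rw [← MvPolynomial.aeval_esymm_eq_multiset_esymm ι K]
    simpa [MvPolynomial.psum] using
      congrArg (MvPolynomial.aeval f) (MvPolynomial.mul_esymm_eq_sum ι K k)
  induction k using Nat.strong_induction_on with
  | _ k ih =>
    rcases k.eq_zero_or_pos with rfl | hpos
    · simp [Multiset.esymm]
    · apply mul_left_cancel₀ (Nat.cast_ne_zero.mpr hpos.ne' : (k : K) ≠ 0)
      rw [newton f, newton g]
      congr 1
      refine sum_congr rfl fun a ha ↦ ?_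
      obtain ⟨hak, hlt⟩ := mem_filter.mp ha
      have hsum := mem_antidiagonal.mp hak
      rw [ih a.1 hlt (by lia), h a.2 (by lia)]

/-- A multiset in an integral domain is determined by its cardinality and its elementary symmetric
functions. -/
theorem Multiset.eq_of_esymm_eq {R : Type*} [CommRing R] [IsDomain R] {s t : Multiset R}
    (hcard : s.card = t.card) (h : ∀ k ≤ s.card, s.esymm k = t.esymm k) : s = t := by
  rw [← Polynomial.roots_multiset_prod_X_sub_C s, ← Polynomial.roots_multiset_prod_X_sub_C t,
    Multiset.prod_X_sub_X_eq_sum_esymm, Multiset.prod_X_sub_X_eq_sum_esymm, ← hcard]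
  congr 1
  refine Finset.sum_congr rfl fun k hk ↦ ?_
  rw [h k (Nat.lt_succ_iff.mp (Finset.mem_range.mp hk))]

/-- Two finite families with the same multiset of values differ by a permutation of the indices. -/
theorem Multiset.exists_perm_of_map_univ_eq {ι β : Type*} [Fintype ι] {f g : ι → β}
    (h : Finset.univ.val.map f = Finset.univ.val.map g) :
    ∃ σ : Equiv.Perm ι, ∀ i, g i = f (σ i) := by
  classical
  have hfiber (c : β) : Nonempty ({i // g i = c} ≃ {i // f i = c}) := by
    rw [← Fintype.card_eq]
    have hc := congrArg (Multiset.count c) h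
    rw [Multiset.count_map, Multiset.count_map] at hc
    simpa [Fintype.card_subtype, Finset.card, eq_comm] using hc.symm
  exact ⟨Equiv.ofFiberEquiv fun c ↦ (hfiber c).some,
    fun i ↦ (Equiv.ofFiberEquiv_map _ i).symm⟩

/-- If all multivariate power sums of degree `k` agree on two families of vectors, then so do the
`k`-th power sums of the values of any linear form. -/
theorem Module.Dual.sum_pow_eq_of_sum_prod_pow_eq {ι κ K : Type*} [Fintype ι] [Fintype κ]
    [Field K] {X Y : ι → κ → K} {k : ℕ}
    (h : ∀ α : κ → ℕ, ∑ j, α j = k → ∑ i, ∏ j, X i j ^ α j = ∑ i, ∏ j, Y i j ^ α j)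
    (φ : Module.Dual K (κ → K)) :
    ∑ i, φ (X i) ^ k = ∑ i, φ (Y i) ^ k := by
  classical
  have expand (Z : ι → κ → K) : ∑ i, φ (Z i) ^ k =
      ∑ α ∈ Finset.piAntidiag Finset.univ k, (Nat.multinomial Finset.univ α : K) *
        (∏ j, φ (fun l ↦ if j = l then 1 else 0) ^ α j) * ∑ i, ∏ j, Z i j ^ α j := by
    simp_rw [Finset.mul_sum]
    rw [Finset.sum_comm]
    refine Finset.sum_congr rfl fun i _ ↦ ?_
    simp_rw [φ.pi_apply_eq_sum_univ (Z i), smul_eq_mul]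
    rw [Finset.sum_pow_eq_sum_piAntidiag]
    refine Finset.sum_congr rfl fun α _ ↦ ?_
    rw [mul_assoc, ← Finset.prod_mul_distrib]
    simp_rw [mul_pow, mul_comm]
  rw [expand X, expand Y]
  refine Finset.sum_congr rfl fun α hα ↦ ?_
  rw [h α (Finset.mem_piAntidiag.mp hα).1]

/-- **Proposition 1 (PMP uniqueness).** For matrices `X X' : ℝ^{n×a}` (rows are vectors in
`ℝ^a`), the rows of `X'` are a permutation of the rows of `X` iff all Power-sum
Multi-symmetric Polynomials `p_α` of degree `|α| ≤ n` agree on `X` and `X'`. -/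
theorem pmp_unique_multiset_representation
    (n a : ℕ) (hn : 0 < n) (ha : 0 < a)
    (X X' : Fin n → Fin a → ℝ) :
    (∃ σ : Equiv.Perm (Fin n), ∀ i, X' i = X (σ i)) ↔
      (∀ α : Fin a → ℕ, (∑ j, α j) ≤ n →
        ∑ i, ∏ j, (X i j) ^ (α j) = ∑ i, ∏ j, (X' i j) ^ (α j)) := by
  constructor
  · rintro ⟨σ, hσ⟩ α -
    simp_rw [hσ]
    exact (Equiv.sum_comp σ fun i ↦ ∏ j, X i j ^ α j).symm
  · intro h
    obtain ⟨φ, hφ⟩ := Module.exists_dual_forall_apply_ne_zero (K := ℝ)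
      (fun p : {p : Fin n × Fin n // X' p.1 ≠ X p.2} ↦ X' p.1.1 - X p.1.2)
      fun p ↦ sub_ne_zero.mpr p.2
    have hsum (k : ℕ) (hk : k ≤ n) : ∑ i, φ (X i) ^ k = ∑ i, φ (X' i) ^ k :=
      φ.sum_pow_eq_of_sum_prod_pow_eq fun α hα ↦ h α (hα.trans_le hk)
    obtain ⟨σ, hσ⟩ := Multiset.exists_perm_of_map_univ_eq <|
      Multiset.eq_of_esymm_eq (by simp) fun k hk ↦
        Finset.esymm_map_val_eq_of_sum_pow_eq hsum k (by simpa using hk)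
    refine ⟨σ, fun i ↦ ?_⟩
    by_contra hne
    exact hφ ⟨(i, σ i), hne⟩ (by simpa [sub_eq_zero] using hσ i)
end

section
/- Let n, a be positive natural numbers and let X, X' ∈ ℝ^{n×a} be two matrices such that no permutation of the rows of X yields X' (i.e., for every g ∈ S_n, g·X ≠ X'). Then there exists a function q : ℝ^{n×a} → ℝ that is a polynomial in the n·a matrix entries, is invariant under row permutations (q(g·Y) = q(Y) for all g ∈ S_n and all Y ∈ ℝ^{n×a}), and satisfies q(X) ≥ 1 and q(X') ≤ 0. -/
/-- The product over all row permutations of `Y` of the squared Euclidean distance to `Z`. -/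
noncomputable def orbitSqDistProd {n a : ℕ} (Z Y : Fin n → Fin a → ℝ) : ℝ :=
  ∏ h : Equiv.Perm (Fin n), ∑ i, ∑ j, (Y (h⁻¹ i) j - Z i j) ^ 2

theorem orbitSqDistProd_perm {n a : ℕ} (Z Y : Fin n → Fin a → ℝ) (g : Equiv.Perm (Fin n)) :
    orbitSqDistProd Z (fun i => Y (g⁻¹ i)) = orbitSqDistProd Z Y := by
  unfold orbitSqDistProd
  refine Fintype.prod_equiv (Equiv.mulRight g) _ _ fun h => ?_
  simp [mul_inv_rev]

theorem orbitSqDistProd_self {n a : ℕ} (Z : Fin n → Fin a → ℝ) : orbitSqDistProd Z Z = 0 :=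
  Finset.prod_eq_zero (Finset.mem_univ 1) (by simp)

theorem orbitSqDistProd_pos {n a : ℕ} {Z Y : Fin n → Fin a → ℝ}
    (hsep : ∀ g : Equiv.Perm (Fin n), (fun i => Y (g⁻¹ i)) ≠ Z) : 0 < orbitSqDistProd Z Y := by
  refine Finset.prod_pos fun g _ => ?_
  obtain ⟨i, hi⟩ := Function.ne_iff.1 (hsep g)
  obtain ⟨j, hj⟩ := Function.ne_iff.1 hi
  refine Finset.sum_pos' (fun i _ => Finset.sum_nonneg fun j _ => sq_nonneg _)
    ⟨i, Finset.mem_univ i, Finset.sum_pos' (fun j _ => sq_nonneg _) ⟨j, Finset.mem_univ j, ?_⟩⟩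
  exact sq_pos_of_ne_zero (sub_ne_zero.2 hj)

theorem exists_mvPolynomial_eval_eq_orbitSqDistProd {n a : ℕ} (Z : Fin n → Fin a → ℝ) :
    ∃ P : MvPolynomial (Fin n × Fin a) ℝ, ∀ Y : Fin n → Fin a → ℝ,
      orbitSqDistProd Z Y = MvPolynomial.eval (fun p => Y p.1 p.2) P :=
  ⟨∏ h : Equiv.Perm (Fin n), ∑ i, ∑ j,
    (MvPolynomial.X (h⁻¹ i, j) - MvPolynomial.C (Z i j)) ^ 2,
    fun Y => by simp [orbitSqDistProd]⟩

/-- If no row permutation of `X` equals `X'`, then there is a multi-symmetric polynomial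
`q` (a polynomial in the `n·a` matrix entries, invariant under row permutations) with
`q(X) ≥ 1` and `q(X') ≤ 0`. -/
theorem multisymmetric_polynomial_separates_orbits
    (n a : ℕ) (hn : 0 < n) (ha : 0 < a)
    (X X' : Fin n → Fin a → ℝ)
    (hsep : ∀ g : Equiv.Perm (Fin n), (fun i => X (g⁻¹ i)) ≠ X') :
    ∃ q : (Fin n → Fin a → ℝ) → ℝ,
      (∃ P : MvPolynomial (Fin n × Fin a) ℝ,
        ∀ Y : Fin n → Fin a → ℝ, q Y = MvPolynomial.eval (fun p => Y p.1 p.2) P) ∧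
      (∀ (g : Equiv.Perm (Fin n)) (Y : Fin n → Fin a → ℝ),
        q (fun i => Y (g⁻¹ i)) = q Y) ∧
      1 ≤ q X ∧ q X' ≤ 0 := by
  obtain ⟨P, hP⟩ := exists_mvPolynomial_eval_eq_orbitSqDistProd X'
  have hpos := orbitSqDistProd_pos hsep
  refine ⟨fun Y => (orbitSqDistProd X' X)⁻¹ * orbitSqDistProd X' Y,
    ⟨MvPolynomial.C (orbitSqDistProd X' X)⁻¹ * P, fun Y => ?_⟩, fun g Y => ?_, ?_, ?_⟩
  · simp [hP Y]
  · simp only [orbitSqDistProd_perm]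
  · exact (inv_mul_cancel₀ hpos.ne').ge
  · simp [orbitSqDistProd_self]
end

section
/- Let n, k, a be positive natural numbers, and let τ : ℝ^a → ℝ^b be the monomial lift τ(x) = (x^α : α ∈ ℕ^a, |α| ≤ n), where x^α = x_1^{α_1}···x_a^{α_a} and b is the number of multi-indices α ∈ ℕ^a with |α| ≤ n. For a tensor B ∈ ℝ^{n^k × a}, j ∈ {1,…,k}, and i = (i_1,…,i_k) ∈ [n]^k, define S_j(B, i) = Σ_{i'=1}^n τ(B_{i_1,…,i_{j-1}, i', i_{j+1},…,i_k, :}) ∈ ℝ^b. Then for any two tensors B, B' ∈ ℝ^{n^k × a}, any j, j' ∈ {1,…,k}, and any k-tuples i, i'' ∈ [n]^k: S_j(B, i) = S_{j'}(B', i'') if and only if the multisets {{ B_{l, :} : l ∈ N_j(i) }} and {{ B'_{l, :} : l ∈ N_{j'}(i'') }} of vectors in ℝ^a are equal. -/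
/-- In characteristic zero, two families of size `m` with the same power sums up to degree `m`
agree as multisets. -/
theorem multiset_map_eq_of_sum_pow_eq {K σ : Type*} [Field K] [CharZero K] [Fintype σ]
    {f g : σ → K} (h : ∀ m ≤ Fintype.card σ, ∑ i, f i ^ m = ∑ i, g i ^ m) :
    Finset.univ.val.map f = Finset.univ.val.map g := by
  have esymm_eq : ∀ m ≤ Fintype.card σ, MvPolynomial.aeval f (MvPolynomial.esymm σ K m) =
      MvPolynomial.aeval g (MvPolynomial.esymm σ K m) := by
    intro m
    induction m using Nat.strong_induction_on with
    | _ m ih =>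
      intro hm
      rcases Nat.eq_zero_or_pos m with rfl | hpos
      · simp
      have newton := MvPolynomial.mul_esymm_eq_sum σ K m
      have hf := congrArg (MvPolynomial.aeval f) newton
      have hg := congrArg (MvPolynomial.aeval g) newton
      simp only [map_mul, map_pow, map_neg, map_one, map_natCast, map_sum] at hf hg
      refine mul_left_cancel₀ (Nat.cast_ne_zero.mpr hpos.ne' : (m : K) ≠ 0) ?_
      rw [hf, hg]
      congr 1
      refine Finset.sum_congr rfl fun p hp => ?_
      obtain ⟨hsum, hlt⟩ := Finset.mem_filter.mp hp
      rw [Finset.HasAntidiagonal.mem_antidiagonal] at hsum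
      rw [ih p.1 hlt (by lia)]
      congr 1
      simpa [MvPolynomial.psum] using h p.2 (by lia)
  rw [← Polynomial.roots_multiset_prod_X_sub_C (Finset.univ.val.map f),
    ← Polynomial.roots_multiset_prod_X_sub_C (Finset.univ.val.map g),
    Multiset.prod_X_sub_X_eq_sum_esymm, Multiset.prod_X_sub_X_eq_sum_esymm]
  simp only [Multiset.card_map]
  congr 1
  refine Finset.sum_congr rfl fun m hm => ?_
  have hm' : m ≤ Fintype.card σ := Nat.lt_succ_iff.mp (Finset.mem_range.mp hm)
  rw [← MvPolynomial.aeval_esymm_eq_multiset_esymm σ K,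
    ← MvPolynomial.aeval_esymm_eq_multiset_esymm σ K, esymm_eq m hm']

/-- Over an infinite field, any finite set of vectors is separated by some linear functional. -/
theorem exists_dual_injOn {K V : Type*} [Field K] [Infinite K] [AddCommGroup V] [Module K V]
    {s : Set V} (hs : s.Finite) : ∃ φ : Module.Dual K V, Set.InjOn φ s := by
  have : Finite s := hs
  obtain ⟨φ, hφ⟩ := Module.exists_dual_forall_apply_ne_zero (K := K)
    (fun p : {p : s × s // p.1 ≠ p.2} => (p.1.1 : V) - p.1.2)
    fun p => sub_ne_zero.mpr fun h => p.2 (Subtype.ext h)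
  refine ⟨φ, fun x hx y hy hxy => ?_⟩
  by_contra hne
  refine hφ ⟨(⟨x, hx⟩, ⟨y, hy⟩), fun h => hne (congrArg Subtype.val h)⟩ ?_
  simp [hxy]

/-- The `m`-th power sum of a linear functional along a family of vectors is determined by the
monomial sums of total degree `m`. -/
theorem sum_dual_pow_eq_of_monomial_sum_eq {K σ ι : Type*} [CommRing K] [Fintype σ] [Fintype ι]
    {v w : σ → ι → K} {m : ℕ}
    (h : ∀ α : ι → ℕ, ∑ t, α t = m → ∑ i, ∏ t, v i t ^ α t = ∑ i, ∏ t, w i t ^ α t)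
    (φ : Module.Dual K (ι → K)) : ∑ i, φ (v i) ^ m = ∑ i, φ (w i) ^ m := by
  classical
  have expand : ∀ u : σ → ι → K, ∑ i, φ (u i) ^ m =
      ∑ α ∈ Finset.piAntidiag Finset.univ m, Nat.multinomial Finset.univ α *
        (∏ t, φ (Pi.single t 1) ^ α t) * ∑ i, ∏ t, u i t ^ α t := by
    intro u
    simp_rw [Finset.mul_sum]
    rw [Finset.sum_comm]
    refine Finset.sum_congr rfl fun i _ => ?_
    rw [LinearMap.pi_apply_eq_sum_univ φ (u i), Finset.sum_pow_eq_sum_piAntidiag]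
    refine Finset.sum_congr rfl fun α _ => ?_
    have single_eq (t : ι) : (fun j => if t = j then (1 : K) else 0) = Pi.single t 1 := by
      ext j
      simp [Pi.single_apply, eq_comm]
    simp_rw [single_eq, smul_eq_mul, mul_pow, Finset.prod_mul_distrib]
    ring
  rw [expand v, expand w]
  refine Finset.sum_congr rfl fun α hα => ?_
  rw [h α (Finset.mem_piAntidiag.mp hα).1]

/-- The monomial sums of total degree at most the size of a family of vectors are a complete
invariant of its multiset of values. -/
theorem monomial_sums_eq_iff_multiset_map_eq {K σ ι : Type*} [Field K] [CharZero K]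
    [Fintype σ] [Fintype ι] (v w : σ → ι → K) :
    (∀ α : ι → ℕ, ∑ t, α t ≤ Fintype.card σ →
        ∑ i, ∏ t, v i t ^ α t = ∑ i, ∏ t, w i t ^ α t) ↔
      Finset.univ.val.map v = Finset.univ.val.map w := by
  constructor
  · intro h
    obtain ⟨φ, hφ⟩ := exists_dual_injOn (K := K)
      ((Set.finite_range v).union (Set.finite_range w))
    have hmap : Finset.univ.val.map (fun i => φ (v i)) = Finset.univ.val.map fun i => φ (w i) :=
      multiset_map_eq_of_sum_pow_eq fun m hm =>
        sum_dual_pow_eq_of_monomial_sum_eq (fun α hα => h α (hα.trans_le hm)) φ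
    have hinv := hφ.leftInvOn_invFunOn
    have hmap' := congrArg (Multiset.map (Function.invFunOn φ (Set.range v ∪ Set.range w))) hmap
    simpa [Multiset.map_map, Function.comp_def, hinv (Or.inl ⟨_, rfl⟩),
      hinv (Or.inr ⟨_, rfl⟩)] using hmap'
  · intro h α _
    have := congrArg (fun s => (s.map fun x => ∏ t, x t ^ α t).sum) h
    simpa [Multiset.map_map, Function.comp_def] using this


/-- **The monomial lift followed by `j`-th coordinate summation is a complete invariant
of the WL neighborhood multisets.** For tensors `B, B' : ℝ^{n^k × a}`, coordinates
`j, j' ∈ [k]`, and `k`-tuples `i, i''`, the sums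
`S_j(B,i)_α = ∑_{i'∈[n]} (B_{i with j ↦ i'})^α` over all multi-indices `|α| ≤ n`
agree iff the corresponding neighborhood multisets of feature vectors agree. -/
theorem monomial_lift_sum_complete_invariant
    (n k a : ℕ) (hn : 0 < n) (hk : 0 < k) (ha : 0 < a)
    (B B' : (Fin k → Fin n) → Fin a → ℝ)
    (j j' : Fin k) (i i'' : Fin k → Fin n) :
    (∀ α : Fin a → ℕ, (∑ t, α t) ≤ n →
        ∑ i' : Fin n, ∏ t, (B (Function.update i j i') t) ^ (α t) =
          ∑ i' : Fin n, ∏ t, (B' (Function.update i'' j' i') t) ^ (α t)) ↔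
      (Finset.univ.val.map fun i' : Fin n => B (Function.update i j i')) =
        (Finset.univ.val.map fun i' : Fin n => B' (Function.update i'' j' i')) := by
  simpa using monomial_sums_eq_iff_multiset_map_eq
    (fun i' : Fin n => B (Function.update i j i'))
    (fun i' : Fin n => B' (Function.update i'' j' i'))
end

section
/- Let n, a be positive natural numbers and let B, B' ∈ ℝ^{n × n × a} be tensors. For i_1, i_2 ∈ [n] let X(B, i_1, i_2) ∈ ℝ^{n × 2a} be the matrix whose j-th row is the concatenation (B_{j,i_2,:}, B_{i_1,j,:}) ∈ ℝ^{2a}. Then for any i_1, i_2, i_1', i_2' ∈ [n], the following are equivalent: (1) for all pairs of multi-indices β, γ ∈ ℕ^a with |β| + |γ| ≤ n, Σ_{j=1}^n (B_{j,i_2,:})^β (B_{i_1,j,:})^γ = Σ_{j=1}^n (B'_{j,i_2',:})^β (B'_{i_1',j,:})^γ; (2) the multisets of vectors in ℝ^{2a} given by the rows of X(B, i_1, i_2) and of X(B', i_1', i_2') are equal, i.e., {{ (B_{j,i_2,:}, B_{i_1,j,:}) : j ∈ [n] }} = {{ (B'_{j,i_2',:}, B'_{i_1',j,:}) : j ∈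 [n] }}. -/
/-- Equal power sums up to degree `m` give equal elementary symmetric functions up to
degree `m`. -/
theorem Finset.esymm_map_univ_eq_of_sum_pow_eq {J K : Type*} [Fintype J] [CommRing K]
    [IsDomain K] [CharZero K] {x y : J → K} {m : ℕ}
    (h : ∀ k ≤ m, ∑ j, x j ^ k = ∑ j, y j ^ k) :
    ∀ k ≤ m, (univ.val.map x).esymm k = (univ.val.map y).esymm k := by
  have newton (z : J → K) (k : ℕ) :
      (k : K) * (univ.val.map z).esymm k = (-1) ^ (k + 1) *
        ∑ a ∈ antidiagonal k with a.1 < k,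
          (-1) ^ a.1 * (univ.val.map z).esymm a.1 * ∑ j, z j ^ a.2 := by
    simp_rw [← MvPolynomial.aeval_esymm_eq_multiset_esymm J K]
    simpa [MvPolynomial.psum] using
      congrArg (MvPolynomial.aeval z) (MvPolynomial.mul_esymm_eq_sum J K k)
  intro k
  induction k using Nat.strong_induction_on with
  | _ k ih =>
    intro hk
    obtain rfl | hk0 := eq_or_ne k 0
    · simp [Multiset.esymm]
    · refine mul_left_cancel₀ (Nat.cast_ne_zero.mpr hk0 : (k : K) ≠ 0) ?_
      rw [newton, newton]
      refine congrArg _ (sum_congr rfl fun a ha => ?_)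
      rw [mem_filter, HasAntidiagonal.mem_antidiagonal] at ha
      rw [ih a.1 ha.2 (by lia), h a.2 (by lia)]

/-- A family of `m` scalars is determined, up to order, by its power sums of degree at
most `m`. -/
theorem Multiset.map_univ_eq_of_sum_pow_eq {J K : Type*} [Fintype J] [CommRing K]
    [IsDomain K] [CharZero K] {x y : J → K}
    (h : ∀ k ≤ Fintype.card J, ∑ j, x j ^ k = ∑ j, y j ^ k) :
    Finset.univ.val.map x = Finset.univ.val.map y := by
  have hesymm := Finset.esymm_map_univ_eq_of_sum_pow_eq h
  rw [← Polynomial.roots_multiset_prod_X_sub_C (Finset.univ.val.map x),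
    ← Polynomial.roots_multiset_prod_X_sub_C (Finset.univ.val.map y),
    Multiset.prod_X_sub_X_eq_sum_esymm, Multiset.prod_X_sub_X_eq_sum_esymm]
  simp only [Multiset.card_map, Finset.card_val, Finset.card_univ]
  refine congrArg _ (Finset.sum_congr rfl fun k hk => ?_)
  rw [hesymm k (Finset.mem_range_succ_iff.mp hk)]

/-- Some linear functional separates the distinct values of a finite family of vectors. -/
theorem Module.exists_dual_apply_eq_iff {P K V : Type*} [Finite P] [Field K] [Infinite K]
    [AddCommGroup V] [Module K V] (z : P → V) :
    ∃ f : Module.Dual K V, ∀ p q, f (z p) = f (z q) ↔ z p = z q := by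
  obtain ⟨f, hf⟩ := Module.exists_dual_forall_apply_ne_zero (K := K)
    (fun i : {i : P × P // z i.1 ≠ z i.2} => z i.1.1 - z i.1.2)
    (fun i => sub_ne_zero.mpr i.2)
  refine ⟨f, fun p q => ⟨fun h => ?_, fun h => by rw [h]⟩⟩
  by_contra hne
  exact hf ⟨(p, q), hne⟩ (by simp [h])

/-- A finite family of vectors is determined, up to order, by its images under all linear
functionals, each taken up to order. -/
theorem Multiset.map_univ_eq_of_forall_dual {J K V : Type*} [Fintype J] [Field K] [Infinite K]
    [AddCommGroup V] [Module K V] {x y : J → V}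
    (h : ∀ f : Module.Dual K V,
      (Finset.univ.val.map fun j => f (x j)) = Finset.univ.val.map fun j => f (y j)) :
    Finset.univ.val.map x = Finset.univ.val.map y := by
  obtain ⟨f, hf⟩ := Module.exists_dual_apply_eq_iff (K := K) (Sum.elim x y)
  obtain ⟨g, hg⟩ : ∃ g : K → V, ∀ p, g (f (Sum.elim x y p)) = Sum.elim x y p :=
    ⟨Function.extend (fun p => f (Sum.elim x y p)) (Sum.elim x y) 0, fun p =>
      Function.FactorsThrough.extend_apply (fun p q hpq => (hf p q).mp hpq) 0 p⟩
  have hx (j : J) : g (f (x j)) = x j := hg (Sum.inl j)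
  have hy (j : J) : g (f (y j)) = y j := hg (Sum.inr j)
  simpa [Multiset.map_map, Function.comp_def, hx, hy] using congrArg (Multiset.map g) (h f)

/-- Power sums of a linear functional expand into monomial sums. -/
theorem Module.Dual.sum_pow_eq_sum_monomial {ι J K : Type*} [Fintype ι] [DecidableEq ι]
    [Fintype J] [CommSemiring K] (f : Module.Dual K (ι → K)) (x : J → ι → K) (k : ℕ) :
    ∑ j, f (x j) ^ k = ∑ α ∈ Finset.piAntidiag Finset.univ k,
      Nat.multinomial Finset.univ α * (∏ i, f (Pi.single i 1) ^ α i) *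
        ∑ j, ∏ i, x j i ^ α i := by
  have expand (v : ι → K) : f v = ∑ i, f (Pi.single i 1) * v i := by
    rw [LinearMap.pi_apply_eq_sum_univ f v]
    refine Finset.sum_congr rfl fun i _ => ?_
    rw [smul_eq_mul, mul_comm]
    congr 2
    ext j
    simp [Pi.single_apply, eq_comm]
  simp only [expand (x _), Finset.sum_pow_eq_sum_piAntidiag, mul_pow, Finset.prod_mul_distrib,
    Finset.mul_sum, mul_assoc]
  exact Finset.sum_comm

/-- A family of `m` vectors is determined, up to order, by its multivariate power sums of
total degree at most `m`. -/
theorem Multiset.map_univ_eq_of_sum_monomial_eq {ι J K : Type*} [Fintype ι] [Fintype J]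
    [Field K] [CharZero K] {x y : J → ι → K}
    (h : ∀ α : ι → ℕ, ∑ i, α i ≤ Fintype.card J →
      ∑ j, ∏ i, x j i ^ α i = ∑ j, ∏ i, y j i ^ α i) :
    Finset.univ.val.map x = Finset.univ.val.map y := by
  classical
  refine Multiset.map_univ_eq_of_forall_dual (K := K) fun f =>
    Multiset.map_univ_eq_of_sum_pow_eq fun k hk => ?_
  rw [f.sum_pow_eq_sum_monomial, f.sum_pow_eq_sum_monomial]
  refine Finset.sum_congr rfl fun α hα => ?_
  rw [h α ((Finset.mem_piAntidiag.mp hα).1.trans_le hk)]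

/-- **The matrix-product features are a complete invariant of the 2-FWL neighborhood
multiset.** For tensors `B, B' : ℝ^{n×n×a}` and pairs `(i₁,i₂)`, `(i₁',i₂')`, the sums
`∑_{j∈[n]} (B_{j,i₂,:})^β (B_{i₁,j,:})^γ` over all pairs of multi-indices with
`|β|+|γ| ≤ n` agree iff the multisets `{{(B_{j,i₂,:}, B_{i₁,j,:}) : j ∈ [n]}}` and
`{{(B'_{j,i₂',:}, B'_{i₁',j,:}) : j ∈ [n]}}` of vectors in `ℝ^{2a}` agree. -/
theorem matmul_features_complete_invariant_fwl
    (n a : ℕ) (hn : 0 < n) (ha : 0 < a)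
    (B B' : Fin n → Fin n → Fin a → ℝ)
    (i₁ i₂ i₁' i₂' : Fin n) :
    (∀ β γ : Fin a → ℕ, (∑ t, β t) + (∑ t, γ t) ≤ n →
        ∑ j : Fin n, (∏ t, (B j i₂ t) ^ (β t)) * (∏ t, (B i₁ j t) ^ (γ t)) =
          ∑ j : Fin n, (∏ t, (B' j i₂' t) ^ (β t)) * (∏ t, (B' i₁' j t) ^ (γ t))) ↔
      (Finset.univ.val.map fun j : Fin n => Sum.elim (B j i₂) (B i₁ j)) =
        (Finset.univ.val.map fun j : Fin n => Sum.elim (B' j i₂') (B' i₁' j)) := by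
  constructor
  · intro h
    refine Multiset.map_univ_eq_of_sum_monomial_eq fun α hα => ?_
    simpa [Fintype.prod_sum_type] using
      h (fun t => α (Sum.inl t)) (fun t => α (Sum.inr t))
        (by simpa [Fintype.sum_sum_type] using hα)
  · intro h β γ _
    simpa [List.sum_ofFn] using
      congrArg (fun s => (s.map fun v : Fin a ⊕ Fin a → ℝ =>
        (∏ t, v (Sum.inl t) ^ β t) * ∏ t, v (Sum.inr t) ^ γ t).sum) h
end

section
/- Let n, a, b, b' be positive natural numbers and let m_1, m_2 : ℝ^a → ℝ^b and m_3 : ℝ^a → ℝ^{b'} be arbitrary functions. Define the block map Bl : ℝ^{n×n×a} → ℝ^{n×n×(b'+b)} as follows: for an input tensor X, apply each m_l entrywise along the feature dimension, m_l(X)_{i_1,i_2,:} = m_l(X_{i_1,i_2,:}); then set W_{:,:,j} = m_1(X)_{:,:,j} · m_2(X)_{:,:,j} (matrix product of matching feature slices) for j ∈ [b]; the output is the concatenation Bl(X) = (m_3(X), W). Let g ∈ S_n act on tensors by (g·X)_{i_1,i_2,:} = X_{g^{-1}(i_1), g^{-1}(i_2),:}. Then Bl is equivariant: Bl(g·X)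 = g·Bl(X) for every g ∈ S_n and every X ∈ ℝ^{n×n×a}. -/
/-- The building block of the model: apply `m₁, m₂, m₃` entrywise along the feature
dimension, multiply matching feature slices of `m₁(X)` and `m₂(X)` as matrices, and
concatenate the result with `m₃(X)`. -/
def blockMap (n a b b' : ℕ)
    (m₁ m₂ : (Fin a → ℝ) → Fin b → ℝ) (m₃ : (Fin a → ℝ) → Fin b' → ℝ)
    (X : Fin n → Fin n → Fin a → ℝ) :
    Fin n → Fin n → (Fin b' ⊕ Fin b) → ℝ :=
  fun i₁ i₂ =>
    Sum.elim (m₃ (X i₁ i₂))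
      (fun j => ∑ l : Fin n, m₁ (X i₁ l) j * m₂ (X l i₂) j)

/-- **Lemma 1 (core): the block is permutation-equivariant.** With `S_n` acting by
`(g·X)_{i₁,i₂,:} = X_{g⁻¹(i₁),g⁻¹(i₂),:}`, we have `Bl(g·X) = g·Bl(X)` for every
permutation `g` and every input tensor `X`. -/
theorem blockMap_equivariant
    (n a b b' : ℕ) (hn : 0 < n) (ha : 0 < a) (hb : 0 < b) (hb' : 0 < b')
    (m₁ m₂ : (Fin a → ℝ) → Fin b → ℝ) (m₃ : (Fin a → ℝ) → Fin b' → ℝ)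
    (g : Equiv.Perm (Fin n)) (X : Fin n → Fin n → Fin a → ℝ) :
    blockMap n a b b' m₁ m₂ m₃ (fun i₁ i₂ => X (g⁻¹ i₁) (g⁻¹ i₂)) =
      fun i₁ i₂ => blockMap n a b b' m₁ m₂ m₃ X (g⁻¹ i₁) (g⁻¹ i₂) := by
  funext i₁ i₂ k
  rcases k with k | j
  · rfl
  · exact Equiv.sum_comp g⁻¹ fun l => m₁ (X (g⁻¹ i₁) l) j * m₂ (X l (g⁻¹ i₂)) j
end
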